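/- arXiv:1509.01145 — 2 statements merged into one kernel-verified Lean document; each statement's English description precedes it below -/
import Mathlib

section
/- Every holomorphic complex affine structure on a two-dimensional complex torus is translation invariant. Precisely: let Λ be a lattice in ℂ², let δ : ℂ² → ℂ² be a holomorphic local homeomorphism, and let h : Λ → AffEq(ℂ²) be a group homomorphism into the group of affine automorphisms of ℂ² (maps x ↦ A x + b with A ∈ GL(2,ℂ), b ∈ ℂ²) such that δ(x+λ) = h(λ)(δ(x)) for all x ∈ ℂ² and λ ∈ Λ. Then for every v ∈ ℂ² there exists an affine automorphism g of ℂ² with δ(x+v) = g(δ(x)) for all x ∈ ℂ². -/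
open MeasureTheory Metric Set
open scoped Topology Real

section
variable {V W : Type*} [NormedAddCommGroup V] [NormedSpace ℂ V] [FiniteDimensional ℂ V]
  [NormedAddCommGroup W] [NormedSpace ℂ W] [FiniteDimensional ℂ W]

/-- By the Cauchy integral formula, directional derivatives of a holomorphic map are holomorphic. -/
theorem differentiable_fderiv_apply_of_differentiable {f : V → W} (hf : Differentiable ℂ f)
    (w : V) :
    Differentiable ℂ fun x => fderiv ℂ f x w := by
  have : CompleteSpace W := FiniteDimensional.complete ℂ W
  have : ProperSpace V := FiniteDimensional.proper ℂ V
  have cauchy (x : V) : fderiv ℂ f x w =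
      (2 * π * Complex.I : ℂ)⁻¹ • ∮ z in C(0, 1), ((z - 0) ^ 2)⁻¹ • f (x + z • w) := by
    have hd : Differentiable ℂ fun z : ℂ => f (x + z • w) := by fun_prop
    rw [Complex.two_pi_I_inv_smul_circleIntegral_sub_sq_inv_smul_of_differentiable isOpen_univ
      (subset_univ _) hd.differentiableOn (mem_ball_self one_pos)]
    have h1 : HasDerivAt (fun z : ℂ => x + z • w) w 0 := by
      simpa using ((hasDerivAt_id (0 : ℂ)).smul_const w).const_add x
    have h2 : HasFDerivAt f (fderiv ℂ f x) (x + (0 : ℂ) • w) := by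
      simpa using (hf x).hasFDerivAt
    exact (h2.comp_hasDerivAt (0 : ℂ) h1).deriv.symm
  intro x₀
  simp_rw [cauchy, circleIntegral]
  refine DifferentiableAt.const_smul ?_ _
  set k : ℝ → ℂ := fun θ => deriv (circleMap 0 1) θ * ((circleMap 0 1 θ - 0) ^ 2)⁻¹ with hk
  have hk_norm (θ : ℝ) : ‖k θ‖ = 1 := by simp [hk]
  have hk_cont : Continuous k := by
    have : ∀ θ : ℝ, circleMap 0 1 θ ≠ 0 := fun θ => circleMap_ne_center one_ne_zero
    simp only [hk, deriv_circleMap, sub_zero]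
    fun_prop (disch := simp [this])
  obtain ⟨C, hC⟩ : ∃ C, ∀ y ∈ closedBall x₀ (‖w‖ + 1 + 1), ‖f y‖ ≤ C :=
    (isCompact_closedBall _ _).exists_bound_of_continuousOn hf.continuous.continuousOn
  have hbound {y : V} (hy : y ∈ closedBall x₀ (‖w‖ + 1)) : ‖fderiv ℂ f y‖ ≤ (C + C) / 1 := by
    refine Complex.norm_fderiv_le_div_of_mapsTo_ball hf.differentiableOn (fun z hz => ?_) one_pos
    have hy' : dist y x₀ ≤ ‖w‖ + 1 := hy
    have hz' : dist z y < 1 := hz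
    rw [mem_closedBall, dist_eq_norm]
    refine (norm_sub_le _ _).trans (add_le_add (hC z ?_) (hC y ?_)) <;> rw [mem_closedBall]
    · linarith [dist_triangle z y x₀]
    · linarith
  have key := intervalIntegral.hasFDerivAt_integral_of_dominated_of_fderiv_le (𝕜 := ℂ)
    (μ := volume) (a := 0) (b := 2 * π) (x₀ := x₀) (s := ball x₀ 1) (bound := fun _ => C + C)
    (F := fun x θ => k θ • f (x + circleMap 0 1 θ • w))
    (F' := fun x θ => k θ • fderiv ℂ f (x + circleMap 0 1 θ • w))
    (ball_mem_nhds _ one_pos) ?_ ?_ ?_ ?_ ?_ ?_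
  · refine key.differentiableAt.congr_of_eventuallyEq (.of_forall fun x => ?_)
    simp only [hk, smul_smul]
  · refine .of_forall fun x => Continuous.aestronglyMeasurable ?_
    have := hf.continuous
    fun_prop
  · refine Continuous.intervalIntegrable ?_ _ _
    have := hf.continuous
    fun_prop
  · borelize V
    borelize (V →L[ℂ] W)
    have : ProperSpace (V →L[ℂ] W) := FiniteDimensional.proper ℂ _
    refine (hk_cont.aestronglyMeasurable).smul (Measurable.aestronglyMeasurable ?_)
    exact (measurable_fderiv ℂ f).comp (Continuous.measurable (by fun_prop))
  · refine .of_forall fun θ _ x hx => ?_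
    rw [norm_smul, hk_norm, one_mul]
    refine (hbound ?_).trans_eq (div_one _)
    have h1 : dist x x₀ < 1 := hx
    rw [mem_closedBall, dist_eq_norm]
    calc ‖x + circleMap 0 1 θ • w - x₀‖ = ‖(x - x₀) + circleMap 0 1 θ • w‖ := by congr 1; abel
      _ ≤ ‖x - x₀‖ + ‖circleMap 0 1 θ • w‖ := norm_add_le _ _
      _ ≤ ‖w‖ + 1 := by rw [norm_smul, norm_circleMap_zero, abs_one, ← dist_eq_norm]; linarith
  · exact intervalIntegrable_const
  · refine .of_forall fun θ _ x _ => HasFDerivAt.const_smul ?_ _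
    exact (hasFDerivAt_comp_add_right _).mpr (hf _).hasFDerivAt

theorem differentiable_fderiv_of_differentiable {f : V → W} (hf : Differentiable ℂ f) :
    Differentiable ℂ (fderiv ℂ f) := by
  let d := Module.finrank ℂ V
  have hd : d = Module.finrank ℂ (Fin d → ℂ) := (Module.finrank_fin_fun ℂ).symm
  let e₁ := ContinuousLinearEquiv.ofFinrankEq hd
  let e₂ := (e₁.arrowCongr (1 : W ≃L[ℂ] W)).trans (ContinuousLinearEquiv.piRing (Fin d))
  rw [← Function.id_comp (fderiv ℂ f), ← e₂.symm_comp_self]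
  refine e₂.symm.differentiable.comp (differentiable_pi.mpr fun i => ?_)
  exact differentiable_fderiv_apply_of_differentiable hf _

theorem Differentiable.continuousLinearMap_det {U : Type*} [NormedAddCommGroup U] [NormedSpace ℂ U]
    {A : U → V →L[ℂ] V} (hA : Differentiable ℂ A) : Differentiable ℂ fun x => (A x).det := by
  let b := Module.finBasis ℂ V
  have : (fun x => (A x).det) = fun x => (LinearMap.toMatrix b b (A x)).det := by
    ext x; exact (LinearMap.det_toMatrix b _).symm
  rw [this]
  simp only [Matrix.det_apply, LinearMap.toMatrix_apply]
  refine Differentiable.fun_sum fun σ _ => Differentiable.const_smul ?_ _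
  have hentry (i j : Fin (Module.finrank ℂ V)) : Differentiable ℂ fun x => b.repr (A x (b j)) i :=
    (LinearMap.toContinuousLinearMap (b.coord i)).differentiable.comp
      (hA.clm_apply (differentiable_const (b j)))
  exact fun x => (HasFDerivAt.finsetProd fun i _ => (hentry (σ i) i x).hasFDerivAt).differentiableAt

/-- A real character of a lattice extends to a real linear form. -/
theorem exists_strongDual_extending_addMonoidHom {V : Type*} [NormedAddCommGroup V]
    [NormedSpace ℝ V] [FiniteDimensional ℝ V] (Λ : AddSubgroup V) [DiscreteTopology Λ]
    (hΛ : Submodule.span ℝ (Λ : Set V) = ⊤) (φ : Λ →+ ℝ) :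
    ∃ l : StrongDual ℝ V, ∀ a : Λ, l a = φ a := by
  let L : Submodule ℤ V := Λ.toIntSubmodule
  have : DiscreteTopology L := inferInstanceAs (DiscreteTopology Λ)
  have : IsZLattice ℝ L := ⟨hΛ⟩
  have := ZLattice.module_free ℝ L
  let b := Module.Free.chooseBasis ℤ L
  let φ' : L →ₗ[ℤ] ℝ := AddMonoidHom.toIntLinearMap (M := L) φ
  let l : V →ₗ[ℝ] ℝ := (b.ofZLatticeBasis ℝ L).constr ℝ fun i => φ' (b i)
  refine ⟨LinearMap.toContinuousLinearMap l, fun a => ?_⟩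
  have h : (l.restrictScalars ℤ) ∘ₗ L.subtype = φ' := b.ext fun i => by
    have := (b.ofZLatticeBasis ℝ L).constr_basis ℝ (fun i => φ' (b i)) i
    rwa [b.ofZLatticeBasis_apply ℝ L] at this
  exact LinearMap.congr_fun h a

/-- An entire map that is periodic with respect to a lattice is constant. -/
theorem Differentiable.eq_of_periodic {U : Type*} [NormedAddCommGroup U]
    [NormedSpace ℂ U] {f : V → U} (hf : Differentiable ℂ f)
    (Λ : AddSubgroup V) [DiscreteTopology Λ] (hΛ : Submodule.span ℝ (Λ : Set V) = ⊤)
    (hper : ∀ (x : V) (a : Λ), f (x + a) = f x) (x y : V) : f x = f y := by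
  have : FiniteDimensional ℝ V := FiniteDimensional.complexToReal V
  let L : Submodule ℤ V := Λ.toIntSubmodule
  have : DiscreteTopology L := inferInstanceAs (DiscreteTopology Λ)
  have : IsZLattice ℝ L := ⟨hΛ⟩
  exact hf.apply_eq_apply_of_bounded (IsZLattice.isCompact_range_of_periodic L f hf.continuous
    fun z w hw => hper z ⟨w, hw⟩).isBounded x y

/-- An entire function that a lattice multiplies by a character vanishes nowhere, unless it is
identically zero. -/
theorem Differentiable.ne_zero_of_multiplicatively_periodic {J : V → ℂ} (hJ : Differentiable ℂ J)
    (Λ : AddSubgroup V) [DiscreteTopology Λ] (hΛ : Submodule.span ℝ (Λ : Set V) = ⊤)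
    (χ : Λ → ℂ) (hχ_ne : ∀ a, χ a ≠ 0) (hχ : ∀ a b, χ (a + b) = χ a * χ b)
    (hper : ∀ (x : V) (a : Λ), J (x + a) = χ a * J x) {x₀ : V} (hx₀ : J x₀ ≠ 0) (x : V) :
    J x ≠ 0 := by
  have : FiniteDimensional ℝ V := FiniteDimensional.complexToReal V
  let φ : Λ →+ ℝ := AddMonoidHom.mk' (fun a => Real.log ‖χ a‖) fun a b => by
    rw [hχ, norm_mul, Real.log_mul] <;> simp [hχ_ne]
  obtain ⟨l, hl⟩ := exists_strongDual_extending_addMonoidHom Λ hΛ φ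
  let c : StrongDual ℂ V := l.extendRCLike
  have hnorm (x : V) : ‖Complex.exp (-c x)‖ = Real.exp (-l x) := by
    rw [Complex.norm_exp, Complex.neg_re]
    congr 2
    exact StrongDual.re_extendRCLike_apply (𝕜 := ℂ) l x
  set f : V → ℂ := fun x => Complex.exp (-c x) * J x with hf_def
  have hf : Differentiable ℂ f := by fun_prop
  have hf_norm (x : V) : ‖f x‖ = Real.exp (-l x) * ‖J x‖ := by rw [hf_def, norm_mul, hnorm]
  have hf_per (x : V) (a : Λ) : ‖f (x + a)‖ = ‖f x‖ := by
    have ha : Real.exp (φ a) = ‖χ a‖ := Real.exp_log (norm_pos_iff.mpr (hχ_ne a))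
    rw [hf_norm, hf_norm, hper, norm_mul, ← ha, map_add, hl, ← mul_assoc, ← Real.exp_add]
    congr 2; ring
  let L : Submodule ℤ V := Λ.toIntSubmodule
  have : DiscreteTopology L := inferInstanceAs (DiscreteTopology Λ)
  have : IsZLattice ℝ L := ⟨hΛ⟩
  obtain ⟨C, hC⟩ := (IsZLattice.isCompact_range_of_periodic L (fun x => ‖f x‖) hf.continuous.norm
    fun z w hw => hf_per z ⟨w, hw⟩).isBounded.bddAbove
  have hbdd : Bornology.IsBounded (range f) := (isBounded_iff_forall_norm_le).mpr
    ⟨C, by rintro _ ⟨y, rfl⟩; exact hC ⟨y, rfl⟩⟩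
  intro hx
  have h := hf.apply_eq_apply_of_bounded hbdd x x₀
  simp [hf_def, hx, hx₀] at h

theorem exists_det_fderiv_ne_zero_of_isOpenMap {f : V → V} (hf : Differentiable ℂ f)
    (hopen : IsOpenMap f) : ∃ x, (fderiv ℂ f x).det ≠ 0 := by
  by_contra! h
  have : FiniteDimensional ℝ V := FiniteDimensional.complexToReal V
  borelize V
  have h0 : Measure.addHaar (f '' univ) = 0 :=
    addHaar_image_eq_zero_of_det_fderivWithin_eq_zero Measure.addHaar
      (f' := fun x => (fderiv ℂ f x).restrictScalars ℝ)
      (fun x _ => ((hf x).hasFDerivAt.restrictScalars ℝ).hasFDerivWithinAt) fun x _ => by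
        have : ((fderiv ℂ f x : V →ₗ[ℂ] V).restrictScalars ℝ).det = 0 := by
          rw [LinearMap.det_restrictScalars]
          have : LinearMap.det (fderiv ℂ f x : V →ₗ[ℂ] V) = 0 := h x
          simp [this]
        exact this
  exact ((hopen _ isOpen_univ).measure_pos _ ⟨f 0, 0, trivial, rfl⟩).ne' h0

/-- Complex affine structures on complex tori of any dimension are translation invariant. The key
point is that `(D x)⁻¹ * D (x + v)`, where `D` is the derivative of the developing map, is entire
and periodic. -/
theorem exists_affineEquiv_add_of_equivariant (Λ : AddSubgroup V) [DiscreteTopology Λ]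
    (hΛ : Submodule.span ℝ (Λ : Set V) = ⊤) {δ : V → V} (hδ : Differentiable ℂ δ)
    (hopen : IsOpenMap δ) (h : Λ → (V ≃ᵃ[ℂ] V)) (hh : ∀ a b : Λ, h (a + b) = h a * h b)
    (hequiv : ∀ (x : V) (a : Λ), δ (x + a) = h a (δ x)) (v : V) :
    ∃ g : V ≃ᵃ[ℂ] V, ∀ x, δ (x + v) = g (δ x) := by
  have : CompleteSpace V := FiniteDimensional.complete ℂ V
  let D : V → V →L[ℂ] V := fderiv ℂ δ
  have hD : Differentiable ℂ D := differentiable_fderiv_of_differentiable hδ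
  let A (a : Λ) : V →L[ℂ] V := LinearMap.toContinuousLinearMap (h a).linear
  have hA (a : Λ) (y z : V) : h a y = A a (y - z) + h a z := by
    have := (h a).map_vadd z (y - z)
    rwa [vadd_eq_add, sub_add_cancel] at this
  have hDper (x : V) (a : Λ) : D (x + a) = A a * D x := by
    have h1 : HasFDerivAt (fun x => δ (x + a)) (D (x + a)) x :=
      (hasFDerivAt_comp_add_right _).mpr (hδ _).hasFDerivAt
    have h2 : HasFDerivAt (fun x => δ (x + a)) (A a * D x) x := by
      simp_rw [hequiv, fun y => hA a (δ y) 0, sub_zero]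
      exact (((A a).hasFDerivAt).comp x (hδ x).hasFDerivAt).add_const _
    exact h1.unique h2
  have hdet (x : V) : (D x).det ≠ 0 := by
    obtain ⟨x₀, hx₀⟩ := exists_det_fderiv_ne_zero_of_isOpenMap hδ hopen
    refine hD.continuousLinearMap_det.ne_zero_of_multiplicatively_periodic Λ hΛ
      (fun a => LinearMap.det ((h a).linear : V →ₗ[ℂ] V)) (fun a => ?_) (fun a b => ?_)
      (fun y a => ?_) hx₀ x
    · exact (LinearEquiv.isUnit_det' _).ne_zero
    · rw [hh, ← map_mul]; rfl
    · rw [hDper, ← LinearMap.det_toContinuousLinearMap]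
      exact map_mul LinearMap.det _ _
  have hunit (x : V) : IsUnit (D x) := by
    let e := ContinuousLinearMap.toContinuousLinearEquivOfDetNeZero (D x) (hdet x)
    exact ⟨ContinuousLinearEquiv.toUnit e, by ext; rfl⟩
  have hAunit (a : Λ) : IsUnit (A a) :=
    ⟨ContinuousLinearEquiv.toUnit (h a).linear.toContinuousLinearEquiv, by ext; rfl⟩
  have hfactor (v : V) : ∃ C : V →L[ℂ] V, ∀ x, D (x + v) = D x * C := by
    let q (x : V) : V →L[ℂ] V := Ring.inverse (D x) * D (x + v)
    have hq : Differentiable ℂ q := by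
      refine Differentiable.mul (fun x => ?_) (by fun_prop)
      exact (differentiableAt_inverse (hunit x)).comp x (hD x)
    have hq_per (x : V) (a : Λ) : q (x + a) = q x := by
      obtain ⟨u, hu⟩ := hAunit a
      obtain ⟨w, hw⟩ := hunit x
      simp only [q]
      rw [add_right_comm, hDper, hDper, ← hu, ← hw, ← Units.val_mul, Ring.inverse_unit,
        Ring.inverse_unit]
      simp [mul_assoc]
    refine ⟨q 0, fun x => ?_⟩
    rw [← hq.eq_of_periodic Λ hΛ hq_per x 0, Ring.mul_inverse_cancel_left _ _ (hunit x)]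
  choose C hDC using hfactor
  have hcomm (v w : V) : C v * C w = C w * C v := by
    apply (hunit 0).mul_left_cancel
    rw [← mul_assoc, ← mul_assoc, ← hDC, ← hDC, ← hDC, ← hDC, add_right_comm]
  obtain ⟨u, hu⟩ := hunit 0
  obtain ⟨w, hw⟩ := hunit v
  set M : (V →L[ℂ] V)ˣ := w * u⁻¹ with hM
  have hDM (x : V) : D (x + v) = M * D x := by
    have hv : (w : V →L[ℂ] V) = u * C v := by rw [hw, hu, ← hDC, zero_add]
    have hx : D x = u * C x := by rw [hu, ← hDC, zero_add]
    rw [hDC, hM, Units.val_mul, hv, hx, mul_assoc, hcomm]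
    simp [mul_assoc]
  have hconst (x : V) : δ (x + v) - (M : V →L[ℂ] V) (δ x) = δ (0 + v) - (M : V →L[ℂ] V) (δ 0) := by
    have hder (x : V) :
        HasFDerivAt (fun x => δ (x + v) - (M : V →L[ℂ] V) (δ x)) (0 : V →L[ℂ] V) x := by
      have h1 : HasFDerivAt (fun x => δ (x + v)) (D (x + v)) x :=
        (hasFDerivAt_comp_add_right _).mpr (hδ _).hasFDerivAt
      have h2 : HasFDerivAt (fun x => (M : V →L[ℂ] V) (δ x)) ((M : V →L[ℂ] V) * D x) x :=
        ((M : V →L[ℂ] V).hasFDerivAt).comp x (hδ x).hasFDerivAt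
      simpa [hDM] using h1.fun_sub h2
    exact is_const_of_fderiv_eq_zero (fun x => (hder x).differentiableAt)
      (fun x => (hder x).fderiv) x 0
  refine ⟨(ContinuousLinearEquiv.ofUnit M).toLinearEquiv.toAffineEquiv.trans
    (AffineEquiv.constVAdd ℂ V (δ (0 + v) - (M : V →L[ℂ] V) (δ 0))), fun x => ?_⟩
  rw [← hconst x]
  change δ (x + v) = (δ (x + v) - (M : V →L[ℂ] V) (δ x)) + (M : V →L[ℂ] V) (δ x)
  abel
end

/-- Every holomorphic complex affine structure on a two-dimensional complex torus is
translation invariant. -/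
theorem affine_structure_on_two_torus_translation_invariant
    -- `Λ` is a lattice in ℂ²
    (Λ : AddSubgroup (Fin 2 → ℂ)) [DiscreteTopology Λ]
    (hΛ : Submodule.span ℝ (Λ : Set (Fin 2 → ℂ)) = ⊤)
    -- `δ` is a holomorphic local homeomorphism (the developing map)
    (δ : (Fin 2 → ℂ) → (Fin 2 → ℂ))
    (hδ : Differentiable ℂ δ) (hδloc : IsLocalHomeomorph δ)
    -- `h` is the holonomy morphism into the affine group of ℂ²
    (h : Λ → ((Fin 2 → ℂ) ≃ᵃ[ℂ] (Fin 2 → ℂ)))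
    (hh : ∀ a b : Λ, h (a + b) = h a * h b)
    (hequiv : ∀ (x : Fin 2 → ℂ) (l : Λ), δ (x + l) = h l (δ x)) :
    -- the structure is translation invariant
    ∀ v : Fin 2 → ℂ, ∃ g : (Fin 2 → ℂ) ≃ᵃ[ℂ] (Fin 2 → ℂ),
      ∀ x : Fin 2 → ℂ, δ (x + v) = g (δ x) := by
  exact exists_affineEquiv_add_of_equivariant Λ hΛ hδ hδloc.isOpenMap h hh hequiv
end

section
/- Every flat holomorphic Riemannian metric on a two-dimensional complex torus is translation invariant. Precisely: let Λ be a lattice in ℂ², let δ : ℂ² → ℂ² be a holomorphic local homeomorphism, and let h : Λ → G be a group homomorphism into the complex Euclidean group G = O(2,ℂ) ⋉ ℂ² of maps x ↦ A x + b with A a 2×2 complex matrix satisfying AᵀA = 1 and b ∈ ℂ², such that δ(x+λ) = h(λ)(δ(x)) for all x ∈ ℂ² and λ ∈ Λ. Then for every v ∈ ℂ² there exist A ∈ O(2,ℂ) and b ∈ ℂ² with δ(x+v) = A·δ(x) + b for all x ∈ ℂ². -/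
section EntireMaps

open Complex

variable {E F : Type*} [NormedAddCommGroup E] [NormedSpace ℂ E]
  [NormedAddCommGroup F] [NormedSpace ℂ F] [CompleteSpace F]

theorem Differentiable.fderiv_apply_eq_circleIntegral {f : E → F} (hf : Differentiable ℂ f)
    (x v : E) :
    fderiv ℂ f x v =
      (2 * Real.pi * I : ℂ)⁻¹ • ∮ z in C(0, 1), (z ^ 2)⁻¹ • f (x + z • v) := by
  have hd : Differentiable ℂ fun z : ℂ ↦ f (x + z • v) := by fun_prop
  have hc := two_pi_I_inv_smul_circleIntegral_sub_sq_inv_smul_of_differentiable isOpen_univ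
    (Set.subset_univ (Metric.closedBall (0 : ℂ) 1)) hd.differentiableOn
    (Metric.mem_ball_self one_pos)
  simp only [sub_zero] at hc
  rw [hc]
  have hfx : HasFDerivAt f (fderiv ℂ f x) (x + (0 : ℂ) • v) := by
    simpa using (hf x).hasFDerivAt
  have hline : HasDerivAt (fun z : ℂ ↦ x + z • v) v 0 := by
    simpa using ((hasDerivAt_id (0 : ℂ)).smul_const v).const_add x
  exact (hfx.comp_hasDerivAt (0 : ℂ) hline).deriv.symm

variable [FiniteDimensional ℂ E]

theorem Differentiable.continuous_fderiv_complex {f : E → F} (hf : Differentiable ℂ f) :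
    Continuous (fderiv ℂ f) := by
  refine continuous_clm_apply.2 fun v ↦ ?_
  simp_rw [hf.fderiv_apply_eq_circleIntegral _ v, circleIntegral]
  refine Continuous.const_smul ?_ _
  refine intervalIntegral.continuous_parametric_intervalIntegral_of_continuous' ?_ _ _
  have hfc := hf.continuous
  have hne : ∀ p : E × ℝ, (circleMap 0 1 p.2) ^ 2 ≠ 0 := fun p ↦
    pow_ne_zero _ (circleMap_ne_center one_ne_zero)
  simp only [deriv_circleMap, Function.uncurry_def]
  fun_prop (disch := exact hne)

/-- The derivative of an entire map of several complex variables is entire. -/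
theorem Differentiable.differentiable_fderiv_complex {f : E → F} (hf : Differentiable ℂ f) :
    Differentiable ℂ (fderiv ℂ f) := by
  have hfc := hf.continuous
  have hf'c := hf.continuous_fderiv_complex
  have : ProperSpace E := FiniteDimensional.proper ℂ E
  suffices h : ∀ v, Differentiable ℂ fun x ↦ fderiv ℂ f x v by
    let e := (ContinuousLinearEquiv.ofFinrankEq
      (Module.finrank_fin_fun ℂ (n := Module.finrank ℂ E)).symm).arrowCongr
        (ContinuousLinearEquiv.refl ℂ F) |>.trans (ContinuousLinearEquiv.piRing _)
    refine (e.comp_differentiable_iff).1 (differentiable_pi.2 fun i ↦ ?_)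
    exact h _
  intro v x₀
  have hne : ∀ t : ℝ, (circleMap 0 1 t) ^ 2 ≠ 0 := fun t ↦
    pow_ne_zero _ (circleMap_ne_center one_ne_zero)
  simp_rw [hf.fderiv_apply_eq_circleIntegral _ v, circleIntegral]
  refine DifferentiableAt.const_smul ?_ _
  simp only [deriv_circleMap]
  let k : ℝ → ℂ := fun t ↦ circleMap 0 1 t * I * ((circleMap 0 1 t) ^ 2)⁻¹
  have hk : Continuous k := by
    simp only [k]
    fun_prop (disch := exact hne)
  have hF' : Continuous fun p : E × ℝ ↦ k p.2 • fderiv ℂ f (p.1 + circleMap 0 1 p.2 • v) := by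
    fun_prop
  obtain ⟨C, hC⟩ := (((isCompact_closedBall x₀ 1).prod
    (isCompact_uIcc (a := (0 : ℝ)) (b := 2 * Real.pi))).exists_bound_of_continuousOn
      hF'.continuousOn)
  simp_rw [smul_smul]
  refine (intervalIntegral.hasFDerivAt_integral_of_dominated_of_fderiv_le
    (F' := fun x t ↦ k t • fderiv ℂ f (x + circleMap 0 1 t • v)) (bound := fun _ ↦ C)
    (Metric.closedBall_mem_nhds x₀ one_pos) ?_ ?_ ?_ ?_ ?_ ?_).differentiableAt
  · refine Filter.Eventually.of_forall fun x ↦ Continuous.aestronglyMeasurable ?_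
    change Continuous fun t ↦ k t • f (x + circleMap 0 1 t • v)
    fun_prop
  · refine Continuous.intervalIntegrable ?_ _ _
    change Continuous fun t ↦ k t • f (x₀ + circleMap 0 1 t • v)
    fun_prop
  · exact Continuous.aestronglyMeasurable (by fun_prop)
  · exact Filter.Eventually.of_forall fun t ht x hx ↦
      hC (x, t) ⟨hx, Set.uIoc_subset_uIcc ht⟩
  · exact intervalIntegrable_const
  · refine Filter.Eventually.of_forall fun t _ x _ ↦ ?_
    exact ((hasFDerivAt_comp_add_right _).2 (hf _).hasFDerivAt).const_smul (k t)

end EntireMaps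

/-- An entire function that is periodic with respect to a lattice is constant. -/
theorem Differentiable.apply_eq_apply_of_periodic {E F : Type*} [NormedAddCommGroup E]
    [NormedSpace ℂ E] [NormedSpace ℝ E] [FiniteDimensional ℝ E] [NormedAddCommGroup F]
    [NormedSpace ℂ F] {f : E → F} (hf : Differentiable ℂ f)
    (Λ : AddSubgroup E) [DiscreteTopology Λ]
    (hΛ : Submodule.span ℝ (Λ : Set E) = ⊤) (hper : ∀ x, ∀ l ∈ Λ, f (x + l) = f x) (x y : E) :
    f x = f y := by
  let L : Submodule ℤ E := AddSubgroup.toIntSubmodule Λ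
  have : DiscreteTopology L := inferInstanceAs (DiscreteTopology Λ)
  have : IsZLattice ℝ L := ⟨hΛ⟩
  exact hf.apply_eq_apply_of_bounded
    (IsZLattice.isCompact_range_of_periodic L f hf.continuous hper).isBounded x y

/-- A differentiable open map has an injective derivative at some point. -/
theorem IsOpenMap.exists_injective_fderiv {E : Type*} [NormedAddCommGroup E] [NormedSpace ℝ E]
    [FiniteDimensional ℝ E] {f : E → E} (hf : Differentiable ℝ f) (hopen : IsOpenMap f) :
    ∃ x, Function.Injective (fderiv ℝ f x) := by
  by_contra! hsing
  borelize E
  have h0 := MeasureTheory.addHaar_image_eq_zero_of_det_fderivWithin_eq_zero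
    (MeasureTheory.Measure.addHaar (G := E)) (s := Set.univ)
    (fun x _ ↦ (hf x).hasFDerivAt.hasFDerivWithinAt) fun x _ ↦ by
      by_contra hdet
      exact hsing x (LinearMap.ker_eq_bot.1 (by
        by_contra hker
        exact hdet (LinearMap.det_eq_zero_iff_ker_ne_bot.2 hker)))
  exact ((hopen _ isOpen_univ).measure_pos _ (Set.univ_nonempty.image f)).ne' h0

section ConstantMetric

variable {ι E : Type*} [Fintype ι] [NormedAddCommGroup E] [NormedSpace ℂ E]

/-- If the pullback of the standard bilinear form by `f` is constant and `f` has surjective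
derivative at `x`, then the second derivative of `f` vanishes at `x`. -/
theorem fderiv_fderiv_eq_zero_of_dotProduct_eq {f : E → ι → ℂ} (hf : Differentiable ℂ f)
    (hf' : Differentiable ℂ (fderiv ℂ f))
    (hconst : ∀ v w x y, fderiv ℂ f x v ⬝ᵥ fderiv ℂ f x w = fderiv ℂ f y v ⬝ᵥ fderiv ℂ f y w)
    (x : E) (hsurj : Function.Surjective (fderiv ℂ f x)) :
    fderiv ℂ (fderiv ℂ f) x = 0 := by
  set D := fderiv ℂ (fderiv ℂ f) x
  have hsymm : ∀ u v, D u v = D v u := fun u v ↦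
    second_derivative_symmetric (fun y ↦ (hf y).hasFDerivAt) (hf' x).hasFDerivAt u v
  have hanti : ∀ u v w, D u v ⬝ᵥ fderiv ℂ f x w + fderiv ℂ f x v ⬝ᵥ D u w = 0 := by
    intro u v w
    have hcoord : ∀ (v : E) (i : ι), HasFDerivAt (fun y ↦ fderiv ℂ f y v i)
        ((ContinuousLinearMap.proj (R := ℂ) (φ := fun _ : ι ↦ ℂ) i).comp (D.flip v)) x :=
      fun v i ↦ hasFDerivAt_pi'.1 (by
        simpa using (hf' x).hasFDerivAt.clm_apply (hasFDerivAt_const v x)) i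
    have hder := HasFDerivAt.fun_sum (u := Finset.univ)
      fun i _ ↦ (hcoord v i).mul (hcoord w i)
    have hzero : HasFDerivAt
        (fun y ↦ ∑ i, fderiv ℂ f y v i * fderiv ℂ f y w i) (0 : E →L[ℂ] ℂ) x :=
      (hasFDerivAt_const (fderiv ℂ f x v ⬝ᵥ fderiv ℂ f x w) x).congr_of_eventuallyEq
        (Filter.Eventually.of_forall fun y ↦ hconst v w y x)
    have h := congrArg (fun A : E →L[ℂ] ℂ ↦ A u) (hder.unique hzero)
    simp only [dotProduct, ← Finset.sum_add_distrib]
    simpa [add_comm, mul_comm] using h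
  have hskew : ∀ u v w, D u v ⬝ᵥ fderiv ℂ f x w = -(D u w ⬝ᵥ fderiv ℂ f x v) := fun u v w ↦ by
    rw [dotProduct_comm (D u w)]
    exact eq_neg_of_add_eq_zero_left (hanti u v w)
  ext1 u
  ext1 v
  refine dotProduct_eq_zero _ fun w ↦ ?_
  obtain ⟨w, rfl⟩ := hsurj w
  have h : D u v ⬝ᵥ fderiv ℂ f x w = -(D u v ⬝ᵥ fderiv ℂ f x w) := by
    calc D u v ⬝ᵥ fderiv ℂ f x w = -(D u w ⬝ᵥ fderiv ℂ f x v) := hskew u v w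
      _ = -(D w u ⬝ᵥ fderiv ℂ f x v) := by rw [hsymm u w]
      _ = D w v ⬝ᵥ fderiv ℂ f x u := by rw [hskew w u v, neg_neg]
      _ = D v w ⬝ᵥ fderiv ℂ f x u := by rw [hsymm w v]
      _ = -(D v u ⬝ᵥ fderiv ℂ f x w) := hskew v w u
      _ = -(D u v ⬝ᵥ fderiv ℂ f x w) := by rw [hsymm v u]
  exact self_eq_neg.1 h

end ConstantMetric

/-- Every flat holomorphic Riemannian metric on a two-dimensional complex torus is
translation invariant. The holonomy takes values in the complex Euclidean group
`O(2,ℂ) ⋉ ℂ²`, encoded as pairs `(A, b)` with `A ∈ O(2,ℂ)` acting by `x ↦ A x + b`,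
with the semidirect product group law. -/
theorem flat_holomorphic_riemannian_metric_on_two_torus_translation_invariant
    -- `Λ` is a lattice in ℂ²
    (Λ : AddSubgroup (Fin 2 → ℂ)) [DiscreteTopology Λ]
    (hΛ : Submodule.span ℝ (Λ : Set (Fin 2 → ℂ)) = ⊤)
    -- `δ` is a holomorphic local homeomorphism (the developing map)
    (δ : (Fin 2 → ℂ) → (Fin 2 → ℂ))
    (hδ : Differentiable ℂ δ) (hδloc : IsLocalHomeomorph δ)
    -- `h = (hA, hb)` is the holonomy morphism into `O(2,ℂ) ⋉ ℂ²`
    (hA : Λ → Matrix (Fin 2) (Fin 2) ℂ) (hb : Λ → (Fin 2 → ℂ))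
    (hAorth : ∀ l : Λ, hA l ∈ Matrix.orthogonalGroup (Fin 2) ℂ)
    -- group homomorphism for the semidirect product law
    (hhA : ∀ a b : Λ, hA (a + b) = hA a * hA b)
    (hhb : ∀ a b : Λ, hb (a + b) = (hA a).mulVec (hb b) + hb a)
    -- equivariance of the developing map
    (hequiv : ∀ (x : Fin 2 → ℂ) (l : Λ),
      δ (x + l) = (hA l).mulVec (δ x) + hb l) :
    -- the structure is translation invariant
    ∀ v : Fin 2 → ℂ, ∃ A ∈ Matrix.orthogonalGroup (Fin 2) ℂ, ∃ b : Fin 2 → ℂ,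
      ∀ x : Fin 2 → ℂ, δ (x + v) = A.mulVec (δ x) + b := by
  have hδ' := hδ.differentiable_fderiv_complex
  have hfderiv : ∀ (x : Fin 2 → ℂ) (l : Λ) (v : Fin 2 → ℂ),
      fderiv ℂ δ (x + l) v = (hA l).mulVec (fderiv ℂ δ x v) := by
    intro x l v
    have hshift : HasFDerivAt (fun y ↦ δ (y + l)) (fderiv ℂ δ (x + l)) x :=
      (hasFDerivAt_comp_add_right _).2 (hδ _).hasFDerivAt
    have haffine : HasFDerivAt (fun y ↦ δ (y + l))
        ((Matrix.toLin' (hA l)).toContinuousLinearMap.comp (fderiv ℂ δ x)) x := by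
      simp_rw [hequiv _ l]
      exact ((Matrix.toLin' (hA l)).toContinuousLinearMap.hasFDerivAt.comp x
        (hδ x).hasFDerivAt).add_const (hb l)
    simpa using congrArg (fun A : (Fin 2 → ℂ) →L[ℂ] (Fin 2 → ℂ) ↦ A v) (hshift.unique haffine)
  have hconst : ∀ v w x y,
      fderiv ℂ δ x v ⬝ᵥ fderiv ℂ δ x w = fderiv ℂ δ y v ⬝ᵥ fderiv ℂ δ y w := by
    intro v w
    have hdiff : Differentiable ℂ fun x ↦ fderiv ℂ δ x v ⬝ᵥ fderiv ℂ δ x w := by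
      simp only [dotProduct]
      fun_prop
    refine hdiff.apply_eq_apply_of_periodic Λ hΛ fun x l hl ↦ ?_
    have horth := (Matrix.mem_orthogonalGroup_iff' (Fin 2) ℂ).1 (hAorth ⟨l, hl⟩)
    have hv := hfderiv x ⟨l, hl⟩
    simp only at hv
    rw [hv v, hv w, Matrix.dotProduct_mulVec, ← Matrix.mulVec_transpose, Matrix.mulVec_mulVec,
      horth, Matrix.one_mulVec]
  have hinj : ∀ x, Function.Injective (fderiv ℂ δ x) := by
    obtain ⟨x₁, hx₁⟩ := hδloc.isOpenMap.exists_injective_fderiv (hδ.restrictScalars ℝ)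
    rw [(hδ x₁).fderiv_restrictScalars ℝ] at hx₁
    have hinj₁ : Function.Injective (fderiv ℂ δ x₁) := hx₁
    have hsurj₁ : Function.Surjective (fderiv ℂ δ x₁) :=
      (LinearMap.injective_iff_surjective (f := (fderiv ℂ δ x₁).toLinearMap)).1 hinj₁
    intro x
    refine (injective_iff_map_eq_zero _).2 fun w hw ↦ ?_
    refine (injective_iff_map_eq_zero _).1 hinj₁ w (dotProduct_eq_zero _ fun u ↦ ?_)
    obtain ⟨u, rfl⟩ := hsurj₁ u
    rw [hconst w u x₁ x, hw, zero_dotProduct]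
  have hzero : ∀ x, fderiv ℂ (fderiv ℂ δ) x = 0 := fun x ↦
    fderiv_fderiv_eq_zero_of_dotProduct_eq hδ hδ' hconst x
      ((LinearMap.injective_iff_surjective (f := (fderiv ℂ δ x).toLinearMap)).1 (hinj x))
  intro v
  have hdiff : Differentiable ℂ fun x ↦ δ (x + v) - δ x := by fun_prop
  have hdiff' : ∀ x, fderiv ℂ (fun x ↦ δ (x + v) - δ x) x = 0 := fun x ↦ by
    rw [fderiv_fun_sub (by fun_prop) (hδ x), fderiv_comp_add_right,
      is_const_of_fderiv_eq_zero hδ' hzero (x + v) x, sub_self]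
  refine ⟨1, one_mem _, δ (0 + v) - δ 0, fun x ↦ ?_⟩
  rw [Matrix.one_mulVec, ← is_const_of_fderiv_eq_zero hdiff hdiff' x 0]
  abel
end
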